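/- Assume: (ii) there exist an open bounded set C with compact closure contained in D and ε₁ ∈ (0,1) such that for every ε with |ε| < ε₁ and every crossing solution x : [0,T] → D of the discontinuous system with x(0) ∈ C, the set {t ∈ [0,T] : h(t, x(t)) = 0} consists of isolated points and at each such t one has ⟨∇h, X_ε⟩·⟨∇h, Y_ε⟩(t, x(t)) > 0; and (iii) a ∈ C satisfies f(a) = 0 and f is differentiable at a with invertible derivative Df(a) (so that a is an isolated zero of f with nonzero Brouwer degree). Then there exists ε₂ > 0 such that for every ε with 0 < |ε| < ε₂ the discontinuous system x' = εF(t,x) + ε²R(t,x,ε) has a T-periodic crossing solution x(·,ε) : ℝ → D, and x(0,ε) → a as ε → 0. -/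

import Mathlib

open Set Filter RealInnerProductSpace

section Brouwer

variable {E : Type*} [NormedAddCommGroup E] [InnerProductSpace ℝ E] [FiniteDimensional ℝ E]

/-- The determinant of `1 + A` is an affine combination, with weights independent of `A`, of the
determinants of `1 + t i • A` at sufficiently many distinct nodes `t i`. -/
lemma exists_weights_det_one_add (s : Finset ℕ) (hs : Module.finrank ℝ E < s.card) (t : ℕ → ℝ)
    (ht : Set.InjOn t s) :
    ∃ c : ℕ → ℝ, ∑ i ∈ s, c i = 1 ∧ ∀ A : E →ₗ[ℝ] E,
      LinearMap.det (1 + A) = ∑ i ∈ s, c i * LinearMap.det (1 + t i • A) := by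
  have hne : s.Nonempty := Finset.card_pos.1 (by omega)
  refine ⟨fun i => (Lagrange.basis s t i).eval 1, ?_, fun A => ?_⟩
  · rw [← Polynomial.eval_finsetSum, Lagrange.sum_basis ht hne, Polynomial.eval_one]
  · let b := Module.finBasis ℝ E
    set M := LinearMap.toMatrix b b A with hM
    let P : Polynomial ℝ := Matrix.det
      ((Polynomial.X : Polynomial ℝ) • M.map Polynomial.C + (1 : Matrix _ _ ℝ).map Polynomial.C)
    have hdeg : P.degree < s.card := by
      refine lt_of_le_of_lt Polynomial.degree_le_natDegree ?_
      have := Polynomial.natDegree_det_X_add_C_le M 1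
      rw [Fintype.card_fin] at this
      exact_mod_cast this.trans_lt hs
    have hev : ∀ r : ℝ, P.eval r = LinearMap.det (1 + r • A) := by
      intro r
      rw [← LinearMap.det_toMatrix b, ← Polynomial.coe_evalRingHom, RingHom.map_det]
      congr 1
      ext i j
      by_cases hij : i = j <;> simp [hM, LinearMap.toMatrix_one, hij] <;> ring
    have h1 := Lagrange.eq_interpolate ht hdeg
    have h2 := congrArg (Polynomial.eval 1) h1
    rw [hev, one_smul, Lagrange.interpolate_apply, Polynomial.eval_finsetSum] at h2
    rw [h2]
    refine Finset.sum_congr rfl fun i _ => ?_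
    rw [Polynomial.eval_mul, Polynomial.eval_C, hev, mul_comm]

/-- A differentiable map into the unit sphere has singular derivative. -/
lemma det_fderiv_eq_zero_of_norm_eq_one {g : E → E} (hg : ∀ x, ‖g x‖ = 1) {x : E} {g' : E →L[ℝ] E}
    (hx : HasFDerivAt g g' x) : g'.det = 0 := by
  have h0 : ∀ v, ⟪g x, g' v⟫ = 0 := by
    intro v
    have h1 := hx.norm_sq
    have h2 : HasFDerivAt (fun y => ‖g y‖ ^ 2) (0 : E →L[ℝ] ℝ) x := by
      simpa [hg] using hasFDerivAt_const (1 : ℝ) x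
    have := DFunLike.congr_fun (h1.unique h2) v
    simpa using this
  by_contra hdet
  have hu : IsUnit (LinearMap.det (g' : E →ₗ[ℝ] E)) := isUnit_iff_ne_zero.2 hdet
  obtain ⟨v, hv⟩ := (LinearEquiv.ofIsUnitDet (v := Module.finBasis ℝ E) (v' := Module.finBasis ℝ E)
    (f := (g' : E →ₗ[ℝ] E)) (by simpa using hu)).surjective (g x)
  have hv' : g' v = g x := hv
  have := h0 v
  rw [hv', real_inner_self_eq_norm_sq, hg] at this
  norm_num at this

omit [FiniteDimensional ℝ E] in
/-- A map which is Lipschitz on the closed unit ball and vanishes on the unit sphere stays Lipschitz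
when extended by zero. -/
lemma lipschitzWith_indicator_closedBall {d : E → E} {K : NNReal}
    (hd : LipschitzOnWith K d (Metric.closedBall 0 1)) (h0 : ∀ x, ‖x‖ = 1 → d x = 0) :
    LipschitzWith K ((Metric.closedBall (0 : E) 1).indicator d) := by
  have key : ∀ x ∈ Metric.closedBall (0 : E) 1, ∀ y ∉ Metric.closedBall (0 : E) 1,
      dist (d x) 0 ≤ K * dist x y := by
    intro x hx y hy
    rw [mem_closedBall_zero_iff] at hx hy
    have hc : ContinuousOn (fun s : ℝ => ‖AffineMap.lineMap x y s‖) (Icc 0 1) := by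
      have : Continuous (fun s : ℝ => ‖AffineMap.lineMap x y s‖) := by
        simp only [AffineMap.lineMap_apply_module]; fun_prop
      exact this.continuousOn
    obtain ⟨s, hs, hs1⟩ := intermediate_value_Icc zero_le_one hc
      (show (1 : ℝ) ∈ Icc _ _ by simpa using ⟨hx, (not_le.1 hy).le⟩)
    have hs1 : ‖AffineMap.lineMap x y s‖ = 1 := hs1
    rw [← h0 _ hs1]
    refine (hd.dist_le_mul x (by simpa using hx) _ (by simp [hs1])).trans ?_
    gcongr
    rw [dist_left_lineMap, Real.norm_of_nonneg hs.1]
    exact mul_le_of_le_one_left dist_nonneg hs.2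
  refine LipschitzWith.of_dist_le_mul fun x y => ?_
  by_cases hx : x ∈ Metric.closedBall (0 : E) 1 <;> by_cases hy : y ∈ Metric.closedBall (0 : E) 1
  · simpa [hx, hy] using hd.dist_le_mul x hx y hy
  · simpa only [indicator_of_mem hx, indicator_of_notMem hy] using key x hx y hy
  · rw [indicator_of_mem hy, indicator_of_notMem hx, dist_comm, dist_comm x]
    exact key y hy x hx
  · simp [hx, hy]; positivity

open MeasureTheory in
/-- A small Lipschitz perturbation of the identity supported in the unit ball preserves its
volume. -/
lemma setIntegral_det_one_add_smul_eq [MeasurableSpace E] [BorelSpace E] {d : E → E}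
    {d' : E → E →L[ℝ] E} {K : NNReal} {t : ℝ} (ht : 0 ≤ t)
    (hd : LipschitzOnWith K d (Metric.closedBall 0 1)) (h0 : ∀ x, ‖x‖ = 1 → d x = 0)
    (hd' : ∀ x ∈ Metric.ball (0 : E) 1, HasFDerivAt d (d' x) x)
    (htK : t * K < 1) (hdet : ∀ x ∈ Metric.ball (0 : E) 1, 0 ≤ (1 + t • d' x).det) :
    ∫ x in Metric.ball (0 : E) 1, (1 + t • d' x).det =
      (volume : Measure E).real (Metric.ball (0 : E) 1) := by
  set w := (Metric.closedBall (0 : E) 1).indicator d with hw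
  have hwL : LipschitzWith K w := lipschitzWith_indicator_closedBall hd h0
  set f : E → E := fun x => x + t • w x with hf
  have happ : ApproximatesLinearOn f ((ContinuousLinearEquiv.refl ℝ E : E ≃L[ℝ] E) : E →L[ℝ] E) univ
      (⟨t, ht⟩ * K) := by
    rw [ApproximatesLinearOn.approximatesLinearOn_iff_lipschitzOnWith]
    refine LipschitzOnWith.of_dist_le_mul fun x _ y _ => ?_
    have := hwL.dist_le_mul x y
    simp only [hf, Pi.sub_apply, ContinuousLinearEquiv.coe_coe, ContinuousLinearEquiv.coe_refl', id,
      add_sub_cancel_left, dist_smul₀, Real.norm_of_nonneg ht]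
    change t * _ ≤ t * K * _
    rw [mul_assoc]
    gcongr
  have hc : Subsingleton E ∨ (⟨t, ht⟩ * K : NNReal) <
      ‖((ContinuousLinearEquiv.refl ℝ E).symm : E →L[ℝ] E)‖₊⁻¹ := by
    rcases subsingleton_or_nontrivial E with hE | hE
    · exact Or.inl hE
    · right
      have : ‖((ContinuousLinearEquiv.refl ℝ E).symm : E →L[ℝ] E)‖₊ = 1 :=
        NNReal.eq (ContinuousLinearMap.norm_id (𝕜 := ℝ) (E := E))
      rw [this, inv_one, ← NNReal.coe_lt_coe]
      exact htK
  have hinj : Function.Injective f := injOn_univ.1 (happ.injOn hc)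
  have hsurj := happ.surjective hc
  have hout : ∀ x, x ∉ Metric.ball (0 : E) 1 → f x = x := by
    intro x hx
    by_cases hx1 : x ∈ Metric.closedBall (0 : E) 1
    · have : ‖x‖ = 1 := le_antisymm (by simpa using hx1) (by simpa using hx)
      simp [hf, hw, hx1, h0 x this]
    · simp only [hf, hw, indicator_of_notMem hx1]; simp
  have himg : f '' Metric.ball (0 : E) 1 = Metric.ball (0 : E) 1 := by
    have h1 : f '' (Metric.ball (0 : E) 1)ᶜ = (Metric.ball (0 : E) 1)ᶜ := by
      conv_rhs => rw [← image_id (Metric.ball (0 : E) 1)ᶜ]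
      exact image_congr hout
    rw [image_compl_eq ⟨hinj, hsurj⟩] at h1
    exact compl_injective h1
  have hder : ∀ x ∈ Metric.ball (0 : E) 1,
      HasFDerivWithinAt f (1 + t • d' x) (Metric.ball (0 : E) 1) x := by
    intro x hx
    have h1 : HasFDerivAt (fun y => y + t • d y) (1 + t • d' x) x :=
      (hasFDerivAt_id x).add ((hd' x hx).const_smul t)
    refine (h1.congr_of_eventuallyEq ?_).hasFDerivWithinAt
    filter_upwards [Metric.isOpen_ball.mem_nhds hx] with y hy
    simp only [hf, hw, indicator_of_mem (Metric.ball_subset_closedBall hy)]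
  have := integral_image_eq_integral_abs_det_fderiv_smul volume measurableSet_ball hder
    hinj.injOn (fun _ => (1 : ℝ))
  rw [himg] at this
  simp only [smul_eq_mul, mul_one, integral_const, measureReal_restrict_apply_univ] at this
  rw [this]
  refine setIntegral_congr_fun measurableSet_ball fun x hx => ?_
  exact (abs_of_nonneg (hdet x hx)).symm

open MeasureTheory in
/-- A continuous map that agrees with the identity outside the unit ball has a zero. -/
theorem exists_add_eq_zero_of_continuous {w : E → E} (hw : Continuous w)
    (hw0 : ∀ x, 1 ≤ ‖x‖ → w x = 0) : ∃ x, x + w x = 0 := by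
  by_contra! hne
  borelize E
  obtain ⟨v, hv, hvw, hvs⟩ := hw.exists_contDiff_approx 1 (ε := fun x => ‖x + w x‖)
    (by fun_prop) (fun x => norm_pos_iff.2 (hne x))
  have hu0 : ∀ x, x + v x ≠ 0 := by
    intro x hx
    have := hvw x
    rw [dist_eq_norm, show v x - w x = -(x + w x) by rw [eq_neg_of_add_eq_zero_right hx]; abel,
      norm_neg] at this
    exact lt_irrefl _ this
  have hv0 : ∀ x, 1 ≤ ‖x‖ → v x = 0 := fun x hx => by
    by_contra h
    exact hvs h (hw0 x hx)
  set g : E → E := fun x => ‖x + v x‖⁻¹ • (x + v x) with hg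
  have hgn : ∀ x, ‖g x‖ = 1 := fun x => by
    rw [hg, norm_smul, norm_inv, norm_norm, inv_mul_cancel₀ (norm_ne_zero_iff.2 (hu0 x))]
  have hgc : ContDiff ℝ 1 g := by
    have : ContDiff ℝ 1 (fun x => x + v x) := contDiff_id.add hv
    exact ((this.norm ℝ hu0).inv fun x => norm_ne_zero_iff.2 (hu0 x)).smul this
  set d : E → E := fun x => g x - x with hd
  have hdc : ContDiff ℝ 1 d := hgc.sub contDiff_id
  have hd0 : ∀ x, ‖x‖ = 1 → d x = 0 := fun x hx => by
    simp [hd, hg, hv0 x hx.ge, hx]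
  have hfc : Continuous (fderiv ℝ d) := hdc.continuous_fderiv one_ne_zero
  have hdd : ∀ x, HasFDerivAt d (fderiv ℝ d x) x := fun x =>
    (hdc.differentiable one_ne_zero x).hasFDerivAt
  obtain ⟨K, hK⟩ := (isCompact_closedBall (0 : E) 1).exists_bound_of_continuousOn hfc.continuousOn
  have hK0 : 0 ≤ K := (norm_nonneg _).trans (hK 0 (by simp))
  have hdL : LipschitzOnWith ⟨K, hK0⟩ d (Metric.closedBall 0 1) :=
    (convex_closedBall _ _).lipschitzOnWith_of_nnnorm_fderiv_le
      (fun x _ => hdc.differentiable one_ne_zero x) hK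
  have hdetc : Continuous fun A : E →L[ℝ] E => (1 + A).det :=
    ContinuousLinearMap.continuous_det.comp (continuous_const.add continuous_id)
  obtain ⟨δ, hδ, hδdet⟩ := Metric.continuousAt_iff.1 (hdetc.continuousAt (x := 0)) 1 one_pos
  set r : ℝ := min δ 1 / (K + 1) with hr
  have hr0 : 0 < r := by positivity
  set t : ℕ → ℝ := fun i => r / (i + 2) with ht
  have ht0 : ∀ i, 0 < t i := fun i => by positivity
  have htK : ∀ i, t i * K < min δ 1 := by
    intro i
    have h1 : t i < r := div_lt_self hr0 (by have := i.cast_nonneg (α := ℝ); linarith)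
    have h2 : r * (K + 1) = min δ 1 := by rw [hr]; field_simp
    nlinarith
  set s := Finset.range (Module.finrank ℝ E + 1)
  obtain ⟨c, hc1, hc⟩ := exists_weights_det_one_add (E := E) s (by simp [s]) t (by
    intro i _ j _ hij
    simp only [ht] at hij
    rw [div_eq_div_iff (by positivity) (by positivity)] at hij
    exact_mod_cast (add_right_cancel (mul_left_cancel₀ hr0.ne' hij)).symm)
  have hint : ∀ i, ∫ x in Metric.ball (0 : E) 1, (1 + t i • fderiv ℝ d x).det =
      (volume : Measure E).real (Metric.ball (0 : E) 1) := by
    intro i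
    refine setIntegral_det_one_add_smul_eq (ht0 i).le hdL hd0 (fun x _ => hdd x)
      ((htK i).trans_le (min_le_right _ _)) fun x hx => ?_
    have h1 : dist (t i • fderiv ℝ d x) 0 < δ := by
      rw [dist_zero_right, norm_smul, Real.norm_of_nonneg (ht0 i).le]
      refine lt_of_le_of_lt ?_ ((htK i).trans_le (min_le_left _ _))
      exact mul_le_mul_of_nonneg_left (hK x (Metric.ball_subset_closedBall hx)) (ht0 i).le
    have h2 := hδdet h1
    have h3 : (1 + (0 : E →L[ℝ] E)).det = 1 := by
      rw [add_zero]; exact LinearMap.det_id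
    rw [h3, Real.dist_eq, abs_lt] at h2
    linarith
  have hzero : ∀ x, (1 + fderiv ℝ d x).det = 0 := by
    intro x
    refine det_fderiv_eq_zero_of_norm_eq_one (x := x) hgn ?_
    have := (hasFDerivAt_id x).add (hdd x)
    refine this.congr_of_eventuallyEq (Eventually.of_forall fun y => ?_)
    simp [hd]
  have hsum : (0 : ℝ) = ∑ i ∈ s, c i * (volume : Measure E).real (Metric.ball (0 : E) 1) := by
    calc (0 : ℝ) = ∫ x in Metric.ball (0 : E) 1, (1 + fderiv ℝ d x).det := by simp [hzero]
      _ = ∫ x in Metric.ball (0 : E) 1, ∑ i ∈ s, c i * (1 + t i • fderiv ℝ d x).det := by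
        refine integral_congr_ae (Eventually.of_forall fun x => ?_)
        exact hc (fderiv ℝ d x)
      _ = ∑ i ∈ s, ∫ x in Metric.ball (0 : E) 1, c i * (1 + t i • fderiv ℝ d x).det := by
        refine integral_finsetSum _ fun i _ => ?_
        have hcont : Continuous fun x => c i * (1 + t i • fderiv ℝ d x).det :=
          continuous_const.mul (hdetc.comp (hfc.const_smul (t i)))
        exact (hcont.continuousOn.integrableOn_compact (isCompact_closedBall 0 1)).mono_set
          Metric.ball_subset_closedBall
      _ = _ := by
        refine Finset.sum_congr rfl fun i _ => ?_
        rw [integral_const_mul, hint]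
  rw [← Finset.sum_mul, hc1, one_mul] at hsum
  have hpos : 0 < (volume : Measure E).real (Metric.ball (0 : E) 1) :=
    ENNReal.toReal_pos (Metric.measure_ball_pos _ _ one_pos).ne' measure_ball_lt_top.ne
  exact hpos.ne hsum

/-- **Brouwer's fixed point theorem** for closed balls. -/
theorem exists_fixedPoint_of_mapsTo_closedBall {φ : E → E} {a : E} {ρ : ℝ} (hρ : 0 < ρ)
    (hφ : ContinuousOn φ (Metric.closedBall a ρ))
    (hmaps : MapsTo φ (Metric.closedBall a ρ) (Metric.closedBall a ρ)) :
    ∃ x ∈ Metric.closedBall a ρ, φ x = x := by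
  set p : E → E := fun y => a + (ρ / max (1 / 2) ‖y‖) • y with hp
  have hmax : ∀ y : E, 0 < max (1 / 2) ‖y‖ := fun y => lt_max_of_lt_left (by norm_num)
  have hpc : Continuous p := by
    have h1 : Continuous fun y : E => max (1 / 2) ‖y‖ := by fun_prop
    exact continuous_const.add
      ((continuous_const.div h1 fun y => (hmax y).ne').smul continuous_id)
  have hpm : ∀ y, p y ∈ Metric.closedBall a ρ := by
    intro y
    rw [mem_closedBall_iff_norm, hp, add_sub_cancel_left, norm_smul, Real.norm_of_nonneg
      (div_pos hρ (hmax y)).le, div_mul_eq_mul_div, div_le_iff₀ (hmax y)]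
    gcongr
    exact le_max_right _ _
  have hφp : Continuous fun y => φ (p y) := hφ.comp_continuous hpc hpm
  set c : E → ℝ := fun y => max 0 (min 1 (2 - 2 * ‖y‖)) with hc
  have hcc : Continuous c := by fun_prop
  obtain ⟨y, hy⟩ := exists_add_eq_zero_of_continuous
    (w := fun y => -(c y • (2 * ρ)⁻¹ • (φ (p y) - a)))
    (hcc.smul ((hφp.sub continuous_const).const_smul _)).neg (fun y hy => by
      have : c y = 0 := max_eq_left ((min_le_right _ _).trans (by linarith))
      simp [this])
  have hy1 : y = c y • (2 * ρ)⁻¹ • (φ (p y) - a) := by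
    rwa [← sub_eq_add_neg, sub_eq_zero] at hy
  have hy2 : ‖y‖ ≤ 1 / 2 := by
    have h1 : ‖φ (p y) - a‖ ≤ ρ := mem_closedBall_iff_norm.1 (hmaps (hpm y))
    have h2 : c y ≤ 1 := max_le zero_le_one (min_le_left _ _)
    have h3 : 0 ≤ c y := le_max_left _ _
    rw [hy1, norm_smul, norm_smul, Real.norm_of_nonneg h3,
      Real.norm_of_nonneg (by positivity : 0 ≤ (2 * ρ)⁻¹)]
    calc c y * ((2 * ρ)⁻¹ * ‖φ (p y) - a‖) ≤ 1 * ((2 * ρ)⁻¹ * ρ) := by gcongr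
      _ = 1 / 2 := by field_simp
  have hy3 : c y = 1 := by
    simp only [hc]
    rw [min_eq_left (by linarith), max_eq_right zero_le_one]
  have hy4 : p y = a + (2 * ρ) • y := by
    simp only [hp]
    rw [max_eq_left hy2]
    congr 2
    ring
  refine ⟨p y, hpm y, ?_⟩
  rw [hy3, one_smul] at hy1
  have hy5 : (2 * ρ) • y = φ (p y) - a := (eq_inv_smul_iff₀ (by positivity)).1 hy1
  calc φ (p y) = a + (φ (p y) - a) := by abel
    _ = p y := by rw [← hy5, hy4]

end Brouwer

section Curves

variable {E : Type*} [NormedAddCommGroup E]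

open ODE ODE.FunSpace Metric in
/-- Picard–Lindelöf in integral form, for a flow that depends continuously on the initial point and
stays in the ball on which the vector field is controlled. -/
lemma IsPicardLindelof.exists_flow_mem_closedBall [NormedSpace ℝ E] [CompleteSpace E]
    {f : ℝ → E → E} {tmin tmax : ℝ}
    {t₀ : Icc tmin tmax} {x₀ : E} {a r L K : NNReal} (hf : IsPicardLindelof f t₀ x₀ a r L K) :
    ∃ α : E → ℝ → E, (∀ x ∈ closedBall x₀ r, LipschitzWith L (α x) ∧
        (∀ t, α x t ∈ closedBall x₀ a) ∧
        ∀ t ∈ Icc tmin tmax, α x t = x + ∫ s in t₀..t, f s (α x s)) ∧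
      ∀ t, ContinuousOn (fun x => α x t) (closedBall x₀ r) := by
  classical
  have key (x) (hx : x ∈ closedBall x₀ r) := FunSpace.exists_isFixedPt_next hf hx
  choose α hα using key
  obtain ⟨L', hL'⟩ := exists_forall_closedBall_funSpace_dist_le_mul hf
  refine ⟨fun x => if hx : x ∈ closedBall x₀ r then (α x hx).compProj else 0,
    fun x hx => ⟨?_, fun t => ?_, fun t ht => ?_⟩, fun t => ?_⟩
  · simp only [dif_pos hx]
    have := (α x hx).lipschitzWith.comp (LipschitzWith.projIcc (t₀.2.1.trans t₀.2.2))
    rwa [mul_one] at this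
  · simp only [dif_pos hx]
    exact compProj_mem_closedBall _ hf.mul_max_le
  · simp only [dif_pos hx]
    conv_lhs => rw [compProj_of_mem ht, ← hα x hx, next_apply]
    rfl
  · refine LipschitzOnWith.continuousOn (K := L')
      (LipschitzOnWith.of_dist_le_mul fun x hx y hy => ?_)
    simp only [dif_pos hx, dif_pos hy]
    refine le_trans ?_ (hL' x y hx hy (α x hx) (α y hy) (hα x hx) (hα y hy))
    rw [compProj_apply, compProj_apply, ← toContinuousMap_apply_eq_apply,
      ← toContinuousMap_apply_eq_apply]
    exact ContinuousMap.dist_apply_le_dist _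

open BoundedContinuousFunction in
/-- Arzelà–Ascoli for equi-Lipschitz sequences of curves in a compact set. -/
lemma exists_subseq_tendsto_of_lipschitzOnWith {T : ℝ} {C : NNReal} {S : Set E} (hS : IsCompact S)
    (hT : 0 ≤ T) (x : ℕ → ℝ → E) (hL : ∀ k, LipschitzOnWith C (x k) (Icc 0 T))
    (hm : ∀ k, MapsTo (x k) (Icc 0 T) S) :
    ∃ ψ : ℕ → ℕ, StrictMono ψ ∧ ∃ y : ℝ → E, LipschitzOnWith C y (Icc 0 T) ∧
      MapsTo y (Icc 0 T) S ∧
      ∀ s ∈ Icc 0 T, Tendsto (fun k => x (ψ k) s) atTop (nhds (y s)) := by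
  let X : ℕ → (Icc (0 : ℝ) T →ᵇ E) := fun k =>
    mkOfCompact ⟨(Icc (0 : ℝ) T).domRestrict (x k), (hL k).continuousOn.domRestrict⟩
  have hX : ∀ k s, X k s = x k s := fun _ _ => rfl
  have hcomp := arzela_ascoli S hS (range X)
    (by rintro _ s ⟨k, rfl⟩; exact hm k s.2)
    (by
      refine UniformEquicontinuous.equicontinuous (LipschitzWith.uniformEquicontinuous _ C ?_)
      rintro ⟨_, k, rfl⟩
      exact (hL k).to_restrict)
  obtain ⟨Y, -, ψ, hψ, hY⟩ := hcomp.isSeqCompact (fun k => subset_closure (mem_range_self k))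
  have hpt : ∀ s : Icc (0 : ℝ) T, Tendsto (fun k => x (ψ k) s) atTop (nhds (Y s)) := fun s =>
    ((continuous_eval_const s).tendsto Y).comp hY
  have hlim : ∀ s ∈ Icc 0 T,
      Tendsto (fun k => x (ψ k) s) atTop (nhds (IccExtend hT Y s)) := fun s hs => by
    rw [IccExtend_of_mem hT Y hs]
    exact hpt ⟨s, hs⟩
  refine ⟨ψ, hψ, IccExtend hT Y, LipschitzOnWith.of_dist_le_mul fun s hs t ht => ?_,
    fun s hs => hS.isClosed.mem_of_tendsto (hlim s hs)
      (Eventually.of_forall fun k => hm (ψ k) hs), hlim⟩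
  exact le_of_tendsto ((hlim s hs).dist (hlim t ht))
    (Eventually.of_forall fun k => (hL (ψ k)).dist_le_mul s hs t ht)

end Curves

section Switched

variable {E : Type*} [NormedAddCommGroup E]

/-- The vector field `P + φ(h) Q`, where `φ` is the sign function or a regularisation of it. -/
def switchedField [NormedSpace ℝ E] (P Q : ℝ → ℝ → E → E) (h : ℝ → E → ℝ)
    (φ : ℝ → ℝ) (ε s : ℝ) (x : E) : E :=
  P ε s x + φ (h s x) • Q ε s x

/-- Uniform regularity on `[-e, e] × [0, T] × K` of the data of a switched vector field. -/
structure IsSwitchedData (T e : ℝ) (K : Set E) (B L : NNReal) (P Q : ℝ → ℝ → E → E)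
    (h : ℝ → E → ℝ) : Prop where
  continuousOn_fst : ContinuousOn (fun p : ℝ × ℝ × E => P p.1 p.2.1 p.2.2)
    (Icc (-e) e ×ˢ Icc 0 T ×ˢ K)
  continuousOn_snd : ContinuousOn (fun p : ℝ × ℝ × E => Q p.1 p.2.1 p.2.2)
    (Icc (-e) e ×ˢ Icc 0 T ×ˢ K)
  continuousOn_switch : ContinuousOn (fun p : ℝ × E => h p.1 p.2) (Icc 0 T ×ˢ K)
  norm_fst_le : ∀ ε ∈ Icc (-e) e, ∀ s ∈ Icc 0 T, ∀ x ∈ K, ‖P ε s x‖ ≤ B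
  norm_snd_le : ∀ ε ∈ Icc (-e) e, ∀ s ∈ Icc 0 T, ∀ x ∈ K, ‖Q ε s x‖ ≤ B
  lipschitz_fst : ∀ ε ∈ Icc (-e) e, ∀ s ∈ Icc 0 T, LipschitzOnWith L (P ε s) K
  lipschitz_snd : ∀ ε ∈ Icc (-e) e, ∀ s ∈ Icc 0 T, LipschitzOnWith L (Q ε s) K
  lipschitz_switch : ∀ s ∈ Icc 0 T, LipschitzOnWith L (h s) K

/-- The continuous piecewise linear regularisation of the sign function with slope `m`. -/
noncomputable def satSign (m u : ℝ) : ℝ := max (-1) (min 1 (m * u))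

lemma abs_satSign_le (m u : ℝ) : |satSign m u| ≤ 1 :=
  abs_le.2 ⟨le_max_left _ _, max_le (by norm_num) (min_le_left _ _)⟩

lemma lipschitzWith_satSign (m : NNReal) : LipschitzWith m (satSign m) := by
  have h : LipschitzWith m (fun u : ℝ => (m : ℝ) * u) := by
    refine LipschitzWith.of_dist_le_mul fun u v => ?_
    rw [Real.dist_eq, Real.dist_eq, ← mul_sub, abs_mul, NNReal.abs_eq]
  exact (h.const_min 1).const_max (-1)

lemma abs_realSign_le (u : ℝ) : |Real.sign u| ≤ 1 := by
  rcases Real.sign_apply_eq u with h | h | h <;> simp [h]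

lemma eventually_sign_eq {u : ℝ} (hu : u ≠ 0) {v : ℕ → ℝ} (hv : Tendsto v atTop (nhds u)) :
    ∀ᶠ k in atTop, Real.sign (v k) = Real.sign u := by
  rcases hu.lt_or_gt with h | h
  · filter_upwards [hv.eventually (gt_mem_nhds h)] with k hk
    rw [Real.sign_of_neg h, Real.sign_of_neg hk]
  · filter_upwards [hv.eventually (lt_mem_nhds h)] with k hk
    rw [Real.sign_of_pos h, Real.sign_of_pos hk]

lemma tendsto_satSign {u : ℝ} (hu : u ≠ 0) {v m : ℕ → ℝ} (hm : Tendsto m atTop atTop)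
    (hv : Tendsto v atTop (nhds u)) :
    Tendsto (fun k => satSign (m k) (v k)) atTop (nhds (Real.sign u)) := by
  refine tendsto_const_nhds.congr' ?_
  rcases hu.lt_or_gt with h | h
  · filter_upwards [(hm.atTop_mul_neg h hv).eventually_le_atBot (-1)] with k hk
    rw [Real.sign_of_neg h, satSign, min_eq_right (by linarith), max_eq_left hk]
  · filter_upwards [(hm.atTop_mul_pos h hv).eventually_ge_atTop 1] with k hk
    rw [Real.sign_of_pos h, satSign, min_eq_left hk, max_eq_right (by norm_num)]

lemma measurable_realSign : Measurable Real.sign := by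
  refine Measurable.ite measurableSet_Iio measurable_const ?_
  exact Measurable.ite measurableSet_Ioi measurable_const measurable_const

namespace IsSwitchedData

variable {T e : ℝ} {K : Set E} {B L : NNReal} {P Q : ℝ → ℝ → E → E} {h : ℝ → E → ℝ}

lemma norm_switchedField_le [NormedSpace ℝ E] (S : IsSwitchedData T e K B L P Q h) {φ : ℝ → ℝ}
    (hφ : ∀ u, |φ u| ≤ 1) {ε s : ℝ} {x : E} (hε : ε ∈ Icc (-e) e) (hs : s ∈ Icc 0 T)
    (hx : x ∈ K) : ‖switchedField P Q h φ ε s x‖ ≤ B + B := by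
  refine norm_add_le_of_le (S.norm_fst_le ε hε s hs x hx) ?_
  rw [norm_smul, Real.norm_eq_abs]
  exact (mul_le_of_le_one_left (norm_nonneg _) (hφ _)).trans (S.norm_snd_le ε hε s hs x hx)

section Limits

variable (S : IsSwitchedData T e K B L P Q h)
include S

lemma continuousOn_fst_curve {ε : ℝ} (hε : ε ∈ Icc (-e) e) {x : ℝ → E}
    (hx : ContinuousOn x (Icc 0 T)) (hxK : MapsTo x (Icc 0 T) K) :
    ContinuousOn (fun s => P ε s (x s)) (Icc 0 T) :=
  S.continuousOn_fst.comp (f := fun s => (ε, s, x s))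
    (continuousOn_const.prodMk (continuousOn_id.prodMk hx)) fun _ hs => ⟨hε, hs, hxK hs⟩

lemma continuousOn_snd_curve {ε : ℝ} (hε : ε ∈ Icc (-e) e) {x : ℝ → E}
    (hx : ContinuousOn x (Icc 0 T)) (hxK : MapsTo x (Icc 0 T) K) :
    ContinuousOn (fun s => Q ε s (x s)) (Icc 0 T) :=
  S.continuousOn_snd.comp (f := fun s => (ε, s, x s))
    (continuousOn_const.prodMk (continuousOn_id.prodMk hx)) fun _ hs => ⟨hε, hs, hxK hs⟩

lemma continuousOn_switch_curve {x : ℝ → E}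
    (hx : ContinuousOn x (Icc 0 T)) (hxK : MapsTo x (Icc 0 T) K) :
    ContinuousOn (fun s => h s (x s)) (Icc 0 T) :=
  S.continuousOn_switch.comp (f := fun s => (s, x s))
    (continuousOn_id.prodMk hx) fun _ hs => ⟨hs, hxK hs⟩

variable [NormedSpace ℝ E]

open MeasureTheory in
lemma aestronglyMeasurable_switchedField {φ : ℝ → ℝ} (hφ : Measurable φ) {ε : ℝ}
    (hε : ε ∈ Icc (-e) e) {x : ℝ → E} (hx : ContinuousOn x (Icc 0 T))
    (hxK : MapsTo x (Icc 0 T) K) :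
    AEStronglyMeasurable (fun s => switchedField P Q h φ ε s (x s))
      (volume.restrict (Icc 0 T)) := by
  refine ((S.continuousOn_fst_curve hε hx hxK).aestronglyMeasurable measurableSet_Icc).add ?_
  refine AEStronglyMeasurable.smul ?_
    ((S.continuousOn_snd_curve hε hx hxK).aestronglyMeasurable measurableSet_Icc)
  exact (hφ.comp_aemeasurable
    ((S.continuousOn_switch_curve hx hxK).aemeasurable measurableSet_Icc)).aestronglyMeasurable

open MeasureTheory in
lemma intervalIntegrable_switchedField {φ : ℝ → ℝ} (hφ : Measurable φ) (hφ1 : ∀ u, |φ u| ≤ 1)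
    {ε : ℝ} (hε : ε ∈ Icc (-e) e) {x : ℝ → E} (hx : ContinuousOn x (Icc 0 T))
    (hxK : MapsTo x (Icc 0 T) K) {t : ℝ} (ht : t ∈ Icc 0 T) :
    IntervalIntegrable (fun s => switchedField P Q h φ ε s (x s)) volume 0 t := by
  have : IntegrableOn (fun s => switchedField P Q h φ ε s (x s)) (Icc 0 T) :=
    Integrable.of_bound (S.aestronglyMeasurable_switchedField hφ hε hx hxK) (B + B)
      ((ae_restrict_iff' measurableSet_Icc).2 (ae_of_all _ fun s hs =>
        S.norm_switchedField_le hφ1 hε hs (hxK hs)))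
  exact (intervalIntegrable_iff_integrableOn_Icc_of_le ht.1).2
    (this.mono_set (Icc_subset_Icc_right ht.2))

open MeasureTheory in
/-- Dominated convergence for switched vector fields along curves whose limit meets the switching
set in a null set of times. -/
lemma tendsto_integral_switchedField {φ : ℕ → ℝ → ℝ} (hφm : ∀ k, Measurable (φ k))
    (hφ1 : ∀ k u, |φ k u| ≤ 1)
    (hφ : ∀ u ≠ 0, ∀ v : ℕ → ℝ, Tendsto v atTop (nhds u) →
      Tendsto (fun k => φ k (v k)) atTop (nhds (Real.sign u)))
    {ε : ℕ → ℝ} {ε₀ : ℝ} (hε : ∀ k, ε k ∈ Icc (-e) e) (hε₀ : Tendsto ε atTop (nhds ε₀))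
    {x : ℕ → ℝ → E} {y : ℝ → E} (hx : ∀ k, ContinuousOn (x k) (Icc 0 T))
    (hxK : ∀ k, MapsTo (x k) (Icc 0 T) K) (hyK : MapsTo y (Icc 0 T) K)
    (hlim : ∀ s ∈ Icc 0 T, Tendsto (fun k => x k s) atTop (nhds (y s)))
    (hnull : volume {s ∈ Icc 0 T | h s (y s) = 0} = 0) {t : ℝ} (ht : t ∈ Icc 0 T) :
    Tendsto (fun k => ∫ s in (0 : ℝ)..t, switchedField P Q h (φ k) (ε k) s (x k s)) atTop
      (nhds (∫ s in (0 : ℝ)..t, switchedField P Q h Real.sign ε₀ s (y s))) := by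
  have hε₀' : ε₀ ∈ Icc (-e) e := isClosed_Icc.mem_of_tendsto hε₀ (Eventually.of_forall hε)
  have hsub : ∀ s ∈ uIoc 0 t, s ∈ Icc 0 T := fun s hs => by
    rw [uIoc_of_le ht.1] at hs
    exact ⟨hs.1.le, hs.2.trans ht.2⟩
  refine intervalIntegral.tendsto_integral_filter_of_dominated_convergence
    (fun _ => (B + B : ℝ)) (Eventually.of_forall fun k => ?_)
    (Eventually.of_forall fun k => ae_of_all _ fun s hs =>
      S.norm_switchedField_le (hφ1 k) (hε k) (hsub s hs) (hxK k (hsub s hs)))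
    intervalIntegrable_const ?_
  · exact (S.aestronglyMeasurable_switchedField (hφm k) (hε k) (hx k) (hxK k)).mono_measure
      (Measure.restrict_mono hsub le_rfl)
  · filter_upwards [measure_eq_zero_iff_ae_notMem.1 hnull] with s hs hst
    have hsT := hsub s hst
    have hne : h s (y s) ≠ 0 := fun h0 => hs ⟨hsT, h0⟩
    have hpt : Tendsto (fun k => (ε k, s, x k s)) atTop
        (nhdsWithin (ε₀, s, y s) (Icc (-e) e ×ˢ Icc 0 T ×ˢ K)) :=
      tendsto_nhdsWithin_iff.2 ⟨hε₀.prodMk_nhds (tendsto_const_nhds.prodMk_nhds (hlim s hsT)),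
        Eventually.of_forall fun k => ⟨hε k, hsT, hxK k hsT⟩⟩
    have hpt' : Tendsto (fun k => (s, x k s)) atTop (nhdsWithin (s, y s) (Icc 0 T ×ˢ K)) :=
      tendsto_nhdsWithin_iff.2 ⟨tendsto_const_nhds.prodMk_nhds (hlim s hsT),
        Eventually.of_forall fun k => ⟨hsT, hxK k hsT⟩⟩
    have hmem : (ε₀, s, y s) ∈ Icc (-e) e ×ˢ Icc 0 T ×ˢ K := ⟨hε₀', hsT, hyK hsT⟩
    exact ((S.continuousOn_fst _ hmem).tendsto.comp hpt).add
      ((hφ _ hne _ ((S.continuousOn_switch (s, y s) ⟨hsT, hyK hsT⟩).tendsto.comp hpt')).smul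
        ((S.continuousOn_snd _ hmem).tendsto.comp hpt))

open MeasureTheory in
/-- Uniform averaging: along curves that stay `O(ε)`-close to a point `z`, the integral of the
regularised switched field is uniformly close to the averaged function at `z`. -/
lemma exists_norm_integral_sub_le (hK : IsCompact K) (hT : 0 ≤ T) (he : 0 ≤ e)
    (hnull : ∀ z ∈ K, volume {s ∈ Icc 0 T | h s z = 0} = 0) (M : ℝ) {η : ℝ} (hη : 0 < η) :
    ∃ δ > 0, ∃ N : ℝ, ∀ ε ∈ Icc (-e) e, |ε| < δ → ∀ m : NNReal, N ≤ m → ∀ z ∈ K, ∀ x : ℝ → E,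
      ContinuousOn x (Icc 0 T) → MapsTo x (Icc 0 T) K →
      (∀ s ∈ Icc 0 T, ‖x s - z‖ ≤ M * |ε|) →
      ‖(∫ s in (0 : ℝ)..T, switchedField P Q h (satSign m) ε s (x s)) -
        ∫ s in (0 : ℝ)..T, switchedField P Q h Real.sign 0 s z‖ ≤ η := by
  by_contra! hcon
  choose ε hεe hε m hm z hz x hxc hxK hxz hbig using
    fun k : ℕ => hcon (1 / ((k : ℝ) + 1)) (by positivity) k
  obtain ⟨z₀, hz₀, ψ, hψ, hzlim⟩ := hK.isSeqCompact hz
  have hε0 : Tendsto ε atTop (nhds 0) :=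
    squeeze_zero_norm (fun k => (hε k).le) tendsto_one_div_add_atTop_nhds_zero_nat
  have hε0' : Tendsto (fun k => ε (ψ k)) atTop (nhds 0) := hε0.comp hψ.tendsto_atTop
  have hmlim : Tendsto (fun k => (m (ψ k) : ℝ)) atTop atTop :=
    (tendsto_atTop_mono hm tendsto_natCast_atTop_atTop).comp hψ.tendsto_atTop
  have hxlim : ∀ s ∈ Icc 0 T, Tendsto (fun k => x (ψ k) s) atTop (nhds z₀) := fun s hs => by
    have h0 : Tendsto (fun k => x (ψ k) s - z (ψ k)) atTop (nhds 0) :=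
      squeeze_zero_norm (fun k => hxz (ψ k) s hs) (by simpa using hε0'.abs.const_mul M)
    simpa using h0.add hzlim
  have hTT : T ∈ Icc 0 T := ⟨hT, le_rfl⟩
  have h1 := S.tendsto_integral_switchedField (φ := fun k => satSign (m (ψ k)))
    (fun k => (lipschitzWith_satSign _).continuous.measurable) (fun k => abs_satSign_le _)
    (fun u hu v hv => tendsto_satSign hu hmlim hv) (fun k => hεe (ψ k)) hε0'
    (x := fun k => x (ψ k)) (y := fun _ => z₀) (fun k => hxc (ψ k)) (fun k => hxK (ψ k))
    (fun _ _ => hz₀) hxlim (hnull z₀ hz₀) hTT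
  have h2 := S.tendsto_integral_switchedField (φ := fun _ => Real.sign)
    (fun _ => measurable_realSign) (fun _ => abs_realSign_le)
    (fun u hu v hv => tendsto_const_nhds.congr' ((eventually_sign_eq hu hv).mono fun _ h => h.symm))
    (ε := fun _ => 0) (fun _ => ⟨by linarith, he⟩) tendsto_const_nhds
    (x := fun k _ => z (ψ k)) (y := fun _ => z₀) (fun _ => continuousOn_const)
    (fun k _ _ => hz (ψ k)) (fun _ _ => hz₀) (fun _ _ => hzlim) (hnull z₀ hz₀) hTT
  have h3 := (h1.sub h2).norm
  rw [sub_self, norm_zero] at h3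
  obtain ⟨k, hk⟩ := (h3.eventually (gt_mem_nhds hη)).exists
  exact (hbig (ψ k)).not_gt hk

end Limits

end IsSwitchedData

end Switched

section Periodic

open MeasureTheory Metric

variable {E : Type*} [NormedAddCommGroup E]

namespace IsSwitchedData

variable {T e : ℝ} {B L : NNReal} {P Q : ℝ → ℝ → E → E} {h : ℝ → E → ℝ}

lemma lipschitzOnWith_switchedField_satSign [NormedSpace ℝ E] {K : Set E}
    (S : IsSwitchedData T e K B L P Q h) (m : NNReal) {ε s : ℝ} (hε : ε ∈ Icc (-e) e)
    (hs : s ∈ Icc 0 T) :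
    LipschitzOnWith (L + (L + m * L * B)) (switchedField P Q h (satSign m) ε s) K := by
  refine LipschitzOnWith.of_dist_le_mul fun x hx y hy => ?_
  have hP := (S.lipschitz_fst ε hε s hs).dist_le_mul x hx y hy
  have hQ := (S.lipschitz_snd ε hε s hs).dist_le_mul x hx y hy
  have hh := (S.lipschitz_switch s hs).dist_le_mul x hx y hy
  have hφ := (lipschitzWith_satSign m).dist_le_mul (h s x) (h s y)
  have hB := S.norm_snd_le ε hε s hs y hy
  have h1 := abs_satSign_le m (h s x)
  simp only [dist_eq_norm, switchedField] at *
  push_cast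
  have hsplit : satSign m (h s x) • Q ε s x - satSign m (h s y) • Q ε s y =
      satSign m (h s x) • (Q ε s x - Q ε s y) +
        (satSign m (h s x) - satSign m (h s y)) • Q ε s y := by
    simp only [smul_sub, sub_smul]; abel
  have h2 : ‖satSign m (h s x) • (Q ε s x - Q ε s y)‖ ≤ L * ‖x - y‖ := by
    rw [norm_smul]
    exact (mul_le_of_le_one_left (norm_nonneg _) h1).trans hQ
  have h3 : ‖(satSign m (h s x) - satSign m (h s y)) • Q ε s y‖ ≤ m * L * ‖x - y‖ * B := by
    rw [norm_smul, mul_assoc (m : ℝ)]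
    exact mul_le_mul (hφ.trans (mul_le_mul_of_nonneg_left hh m.2)) hB (norm_nonneg _)
      (by positivity)
  calc _ = ‖(P ε s x - P ε s y) + (satSign m (h s x) • (Q ε s x - Q ε s y) +
        (satSign m (h s x) - satSign m (h s y)) • Q ε s y)‖ := by rw [← hsplit]; congr 1; abel
    _ ≤ L * ‖x - y‖ + (L * ‖x - y‖ + m * L * ‖x - y‖ * B) :=
        norm_add_le_of_le hP (norm_add_le_of_le h2 h3)
    _ = _ := by ring

lemma isPicardLindelof_satSign [NormedSpace ℝ E] {a : E} {r : NNReal}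
    (S : IsSwitchedData T e (closedBall a r) B L P Q h) (hT : 0 ≤ T) (m : NNReal) {ε : ℝ}
    (hε : ε ∈ Icc (-e) e) (hr : |ε| * (B + B) * T ≤ r / 2) :
    IsPicardLindelof (fun s x => ε • switchedField P Q h (satSign m) ε s x)
      (⟨0, le_rfl, hT⟩ : Icc 0 T) a r (r / 2) (‖ε‖₊ * (B + B))
      (‖ε‖₊ * (L + (L + m * L * B))) where
  lipschitzOnWith s hs := by
    refine LipschitzOnWith.of_dist_le_mul fun x hx y hy => ?_
    rw [dist_smul₀, NNReal.coe_mul, coe_nnnorm, mul_assoc]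
    gcongr
    exact (S.lipschitzOnWith_switchedField_satSign m hε hs).dist_le_mul x hx y hy
  continuousOn x hx := by
    have hc : ContinuousOn (fun _ : ℝ => x) (Icc 0 T) := continuousOn_const
    have hm : MapsTo (fun _ : ℝ => x) (Icc 0 T) (closedBall a r) := fun _ _ => hx
    exact ((S.continuousOn_fst_curve hε hc hm).add
      (((lipschitzWith_satSign m).continuous.comp_continuousOn
        (S.continuousOn_switch_curve hc hm)).smul
          (S.continuousOn_snd_curve hε hc hm))).const_smul ε
  norm_le s hs x hx := by
    rw [norm_smul]
    push_cast
    gcongr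
    exact S.norm_switchedField_le (abs_satSign_le m) hε hs hx
  mul_max_le := by
    simpa [hT, sub_half] using hr

variable [InnerProductSpace ℝ E] [FiniteDimensional ℝ E] {a : E} {r : NNReal}
  {f : E → E} {Df : E ≃L[ℝ] E}

/-- The regularised switched system has periodic solutions near a nondegenerate zero of the
averaged function, with a threshold on `ε` independent of the regularisation. -/
lemma exists_periodic_satSign (S : IsSwitchedData T e (closedBall a r) B L P Q h) (hT : 0 < T)
    (he : 0 ≤ e) (hr : 0 < r)
    (hnull : ∀ z ∈ closedBall a r, volume {s ∈ Icc 0 T | h s z = 0} = 0)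
    (hfeq : ∀ z ∈ closedBall a r, f z = ∫ s in (0 : ℝ)..T, switchedField P Q h Real.sign 0 s z)
    (hfa : f a = 0) (hdf : HasFDerivAt f (Df : E →L[ℝ] E) a) {ρ : ℝ} (hρ : 0 < ρ) :
    ∃ δ > 0, ∃ N : ℝ, ∀ ε ∈ Icc (-e) e, 0 < |ε| → |ε| < δ → ∀ m : NNReal, N ≤ m →
      ∃ x : ℝ → E, LipschitzWith (‖ε‖₊ * (B + B)) x ∧ (∀ t, x t ∈ closedBall a r) ∧
        x 0 ∈ closedBall a ρ ∧ x T = x 0 ∧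
        ∀ t ∈ Icc 0 T, x t = x 0 + ∫ s in (0 : ℝ)..t,
          ε • switchedField P Q h (satSign m) ε s (x s) := by
  have hr' : (0 : ℝ) < r := hr
  set κ : ℝ := ‖(Df.symm : E →L[ℝ] E)‖ + 1 with hκdef
  have hκ : 0 < κ := by positivity
  obtain ⟨ρ₁, hρ₁, hlin⟩ := Metric.eventually_nhds_iff_ball.1
    (hdf.isLittleO.bound (show 0 < 1 / (2 * κ) by positivity))
  set ρ₀ : ℝ := min (min ρ (r / 2)) (ρ₁ / 2) with hρ₀def
  have hρ₀ : 0 < ρ₀ := lt_min (lt_min hρ (by linarith)) (by linarith)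
  have hρ₀ρ : ρ₀ ≤ ρ := (min_le_left _ _).trans (min_le_left _ _)
  have hρ₀r : ρ₀ ≤ r / 2 := (min_le_left _ _).trans (min_le_right _ _)
  have hρ₀ρ₁ : ρ₀ < ρ₁ := (min_le_right _ _).trans_lt (by linarith)
  have hsubr : closedBall a ρ₀ ⊆ closedBall a ((r / 2 : NNReal) : ℝ) :=
    closedBall_subset_closedBall (by push_cast; exact hρ₀r)
  have hsubr' : closedBall a ρ₀ ⊆ closedBall a (r : ℝ) :=
    closedBall_subset_closedBall (by linarith)
  obtain ⟨δ, hδ, N, hN⟩ := S.exists_norm_integral_sub_le (isCompact_closedBall a r) hT.le he hnull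
    ((B + B) * T) (show 0 < ρ₀ / (2 * κ) by positivity)
  refine ⟨min δ (r / 2 / ((B + B) * T + 1)), lt_min hδ (by positivity), N,
    fun ε hε hε0 hεδ m hm => ?_⟩
  have hεr : |ε| * (B + B) * T ≤ r / 2 := by
    have h1 := (lt_div_iff₀ (by positivity)).1 (hεδ.trans_le (min_le_right _ _))
    nlinarith [abs_nonneg ε]
  obtain ⟨α, hα, hαc⟩ :=
    (S.isPicardLindelof_satSign hT.le m hε hεr).exists_flow_mem_closedBall
  have hTT : T ∈ Icc 0 T := ⟨hT.le, le_rfl⟩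
  have h00 : (0 : ℝ) ∈ Icc 0 T := ⟨le_rfl, hT.le⟩
  have hα0 : ∀ z ∈ closedBall a ρ₀, α z 0 = z := fun z hz => by
    simpa using (hα z (hsubr hz)).2.2 0 h00
  have hclose : ∀ z ∈ closedBall a ρ₀, ∀ s ∈ Icc 0 T, ‖α z s - z‖ ≤ (B + B) * T * |ε| :=
    fun z hz s hs => by
      have h1 := (hα z (hsubr hz)).1.dist_le_mul s 0
      rw [hα0 z hz, dist_eq_norm, Real.dist_eq, sub_zero, abs_of_nonneg hs.1] at h1
      push_cast at h1
      rw [Real.norm_eq_abs] at h1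
      refine h1.trans ?_
      nlinarith [mul_le_mul_of_nonneg_left hs.2 (show 0 ≤ |ε| * (B + B : ℝ) by positivity)]
  set I : E → E := fun z => ∫ s in (0 : ℝ)..T, switchedField P Q h (satSign m) ε s (α z s)
  have hI : ∀ z ∈ closedBall a ρ₀, α z T = z + ε • I z := fun z hz => by
    rw [(hα z (hsubr hz)).2.2 T hTT, intervalIntegral.integral_smul]
  have hεne : ε ≠ 0 := abs_pos.1 hε0
  have hIc : ContinuousOn I (closedBall a ρ₀) := by
    refine ContinuousOn.congr (f := fun z => ε⁻¹ • (α z T - z))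
      ((((hαc T).mono hsubr).sub continuousOn_id).const_smul _) fun z hz => ?_
    simp only [hI z hz, add_sub_cancel_left, inv_smul_smul₀ hεne]
  obtain ⟨z, hz, hzfix⟩ := exists_fixedPoint_of_mapsTo_closedBall (φ := fun z => z - Df.symm (I z))
    hρ₀ (continuousOn_id.sub (Df.symm.continuous.comp_continuousOn hIc)) fun z hz => by
      have h1 : ‖I z - f z‖ ≤ ρ₀ / (2 * κ) := by
        rw [hfeq z (hsubr' hz)]
        exact hN ε hε (hεδ.trans_le (min_le_left _ _)) m hm z (hsubr' hz) (α z)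
          (hα z (hsubr hz)).1.continuous.continuousOn (fun s _ => (hα z (hsubr hz)).2.1 s)
          (hclose z hz)
      have hza : ‖z - a‖ ≤ ρ₀ := by simpa [dist_eq_norm] using hz
      have h2 : ‖f z - Df (z - a)‖ ≤ ρ₀ / (2 * κ) := by
        have := hlin z (closedBall_subset_ball hρ₀ρ₁ hz)
        rw [hfa, sub_zero] at this
        refine this.trans ?_
        rw [div_mul_eq_mul_div, one_mul]
        gcongr
      have h3 : z - Df.symm (I z) - a = -(Df.symm ((I z - f z) + (f z - Df (z - a)))) := by
        simp only [sub_add_sub_cancel, map_sub, ContinuousLinearEquiv.symm_apply_apply]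
        abel
      rw [mem_closedBall, dist_eq_norm, h3, norm_neg]
      refine ((Df.symm : E →L[ℝ] E).le_opNorm _).trans ?_
      calc _ ≤ κ * (ρ₀ / (2 * κ) + ρ₀ / (2 * κ)) := by
            gcongr
            · rw [hκdef]; linarith
            · exact norm_add_le_of_le h1 h2
        _ = ρ₀ := by field_simp; norm_num
  have hIz : I z = 0 := by simpa using hzfix
  refine ⟨α z, (hα z (hsubr hz)).1, (hα z (hsubr hz)).2.1, ?_, ?_, fun t ht => ?_⟩
  · rw [hα0 z hz]
    exact closedBall_subset_closedBall hρ₀ρ hz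
  · rw [hα0 z hz, hI z hz, hIz, smul_zero, add_zero]
  · rw [hα0 z hz]
    exact (hα z (hsubr hz)).2.2 t ht

/-- The switched system has periodic solutions near a nondegenerate zero of the averaged function,
provided slow curves meet the switching set in null sets of times. -/
lemma exists_periodic_sign (S : IsSwitchedData T e (closedBall a r) B L P Q h) (hT : 0 < T)
    (he : 0 ≤ e) (hr : 0 < r) {δ₀ : NNReal} (hδ₀ : 0 < δ₀)
    (hnull : ∀ x : ℝ → E, LipschitzOnWith δ₀ x (Icc 0 T) → MapsTo x (Icc 0 T) (closedBall a r) →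
      volume {s ∈ Icc 0 T | h s (x s) = 0} = 0)
    (hfeq : ∀ z ∈ closedBall a r, f z = ∫ s in (0 : ℝ)..T, switchedField P Q h Real.sign 0 s z)
    (hfa : f a = 0) (hdf : HasFDerivAt f (Df : E →L[ℝ] E) a) {ρ : ℝ} (hρ : 0 < ρ) :
    ∃ δ > 0, ∀ ε ∈ Icc (-e) e, 0 < |ε| → |ε| < δ →
      ∃ x : ℝ → E, ContinuousOn x (Icc 0 T) ∧ MapsTo x (Icc 0 T) (closedBall a r) ∧
        x 0 ∈ closedBall a ρ ∧ x T = x 0 ∧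
        ∀ t ∈ Icc 0 T, x t = x 0 + ∫ s in (0 : ℝ)..t,
          ε • switchedField P Q h Real.sign ε s (x s) := by
  obtain ⟨δ, hδ, N, hN⟩ := S.exists_periodic_satSign hT he hr
    (fun z hz => hnull (fun _ => z) (LipschitzOnWith.of_dist_le_mul fun _ _ _ _ => by
      rw [dist_self]; positivity) fun _ _ => hz) hfeq hfa hdf hρ
  refine ⟨min δ (δ₀ / (B + B + 1)), lt_min hδ (by positivity), fun ε hε hε0 hεδ => ?_⟩
  have hslow : ‖ε‖₊ * (B + B) ≤ δ₀ := by
    have h1 := (lt_div_iff₀ (by positivity)).1 (hεδ.trans_le (min_le_right _ _))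
    rw [← NNReal.coe_le_coe]
    push_cast
    rw [Real.norm_eq_abs]
    nlinarith [abs_nonneg ε]
  choose x hxL hxK hxρ hxT hxeq using fun k : ℕ =>
    hN ε hε hε0 (hεδ.trans_le (min_le_left _ _)) (N.toNNReal + k)
      (by push_cast; linarith [Real.le_coe_toNNReal N, k.cast_nonneg (α := ℝ)])
  obtain ⟨ψ, hψ, y, hyL, hyK, hlim⟩ := exists_subseq_tendsto_of_lipschitzOnWith
    (isCompact_closedBall a r) hT.le x (fun k => ((hxL k).weaken hslow).lipschitzOnWith)
    (fun k s _ => hxK k s)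
  have hTT : T ∈ Icc 0 T := ⟨hT.le, le_rfl⟩
  have h00 : (0 : ℝ) ∈ Icc 0 T := ⟨le_rfl, hT.le⟩
  have hmlim : Tendsto (fun k : ℕ => ((N.toNNReal + ψ k : NNReal) : ℝ)) atTop atTop := by
    push_cast
    exact tendsto_atTop_add_const_left _ _
      (tendsto_natCast_atTop_atTop.comp hψ.tendsto_atTop)
  refine ⟨y, hyL.continuousOn, hyK, ?_, ?_, fun t ht => ?_⟩
  · exact isClosed_closedBall.mem_of_tendsto (hlim 0 h00) (Eventually.of_forall fun k => hxρ _)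
  · exact tendsto_nhds_unique (hlim T hTT) ((hlim 0 h00).congr fun k => (hxT _).symm)
  · have hint := S.tendsto_integral_switchedField
      (φ := fun k => satSign (N.toNNReal + ψ k : NNReal))
      (fun k => (lipschitzWith_satSign _).continuous.measurable) (fun k => abs_satSign_le _)
      (fun u hu v hv => tendsto_satSign hu hmlim hv) (ε := fun _ => ε) (fun _ => hε)
      tendsto_const_nhds (x := fun k => x (ψ k)) (fun k => (hxL _).continuous.continuousOn)
      (fun k s _ => hxK _ s) hyK hlim (hnull y hyL hyK) ht
    rw [intervalIntegral.integral_smul]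
    refine tendsto_nhds_unique (hlim t ht)
      (((hlim 0 h00).add (hint.const_smul ε)).congr fun k => ?_)
    rw [← intervalIntegral.integral_smul]
    exact (hxeq (ψ k) t ht).symm

end IsSwitchedData

end Periodic

section Reduction

open MeasureTheory Metric

variable {E : Type*} [NormedAddCommGroup E]

/-- Near a compact set on which the switching surface is transverse to the time direction, slow
curves meet the surface in null sets of times. -/
lemma exists_lipschitz_curve_null [InnerProductSpace ℝ E] {T : ℝ} {K : Set E} (hK : IsCompact K)
    {h ht : ℝ → E → ℝ} {hx : ℝ → E → E}
    (hder : ∀ t, ∀ x ∈ K, HasFDerivAt (fun p : ℝ × E => h p.1 p.2)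
      ((ht t x) • ContinuousLinearMap.fst ℝ ℝ E +
        (innerSL ℝ (hx t x)).comp (ContinuousLinearMap.snd ℝ ℝ E)) (t, x))
    (hhtc : ContinuousOn (fun p : ℝ × E => ht p.1 p.2) (Icc 0 T ×ˢ K))
    (hhxc : ContinuousOn (fun p : ℝ × E => hx p.1 p.2) (Icc 0 T ×ˢ K))
    (htr : ∀ t ∈ Icc 0 T, ∀ x ∈ K, h t x = 0 → ht t x ≠ 0) :
    ∃ δ₀ : NNReal, 0 < δ₀ ∧ ∀ x : ℝ → E, LipschitzOnWith δ₀ x (Icc 0 T) →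
      MapsTo x (Icc 0 T) K → volume {s ∈ Icc 0 T | h s (x s) = 0} = 0 := by
  have hcomp : IsCompact (Icc 0 T ×ˢ K) := isCompact_Icc.prod hK
  have hc : ContinuousOn (fun p : ℝ × E => h p.1 p.2) (Icc 0 T ×ˢ K) := fun p hp =>
    (hder p.1 p.2 hp.2).continuousAt.continuousWithinAt
  have hZ : IsCompact ((Icc 0 T ×ˢ K) ∩ (fun p : ℝ × E => h p.1 p.2) ⁻¹' {0}) :=
    hcomp.of_isClosed_subset (hc.preimage_isClosed_of_isClosed hcomp.isClosed isClosed_singleton)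
      inter_subset_left
  obtain ⟨c, hc0, hcle⟩ := hZ.exists_forall_le' (a := 0) (hhtc.mono inter_subset_left).abs
    fun p hp => abs_pos.2 (htr p.1 hp.1.1 p.2 hp.1.2 hp.2)
  obtain ⟨H, hH⟩ := hcomp.exists_bound_of_continuousOn hhxc
  have hd : 0 < c / (2 * (|H| + 1)) := by positivity
  refine ⟨⟨c / (2 * (|H| + 1)), hd.le⟩, hd, fun x hL hm => ?_⟩
  set d : ℝ := c / (2 * (|H| + 1))
  have hHd : |H| * d ≤ c / 2 := by
    have : d * (2 * (|H| + 1)) = c := div_mul_cancel₀ _ (by positivity)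
    nlinarith
  refine measure_null_of_locally_null _ fun t htZ => ⟨{t}, ?_, measure_singleton t⟩
  have hpt : Tendsto (fun s => (s, x s)) (nhdsWithin t {s ∈ Icc 0 T | h s (x s) = 0})
      (nhds (t, x t)) :=
    (continuousWithinAt_id.prodMk (hL.continuousOn t htZ.1)).mono fun s hs => hs.1
  have hη : 0 < c / (4 * (1 + d)) := by positivity
  filter_upwards [hpt.eventually ((hder t (x t) (hm htZ.1)).isLittleO.bound hη),
    self_mem_nhdsWithin] with s hs hsZ
  have hLs : ‖x s - x t‖ ≤ d * |s - t| := by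
    rw [← dist_eq_norm, ← Real.dist_eq]
    exact hL.dist_le_mul s hsZ.1 t htZ.1
  have hnorm : ‖(s, x s) - (t, x t)‖ ≤ (1 + d) * |s - t| := by
    rw [Prod.mk_sub_mk, Prod.norm_mk, Real.norm_eq_abs]
    exact max_le (by nlinarith [abs_nonneg (s - t)]) (by nlinarith [abs_nonneg (s - t)])
  have hs' : |ht t (x t) * (s - t) + ⟪hx t (x t), x s - x t⟫| ≤ c / 4 * |s - t| := by
    have h1 := hs.trans (mul_le_mul_of_nonneg_left hnorm hη.le)
    simp only [hsZ.2, htZ.2, sub_self, zero_sub, norm_neg, Real.norm_eq_abs] at h1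
    have h2 : c / (4 * (1 + d)) * ((1 + d) * |s - t|) = c / 4 * |s - t| := by field_simp
    rw [h2] at h1
    simpa using h1
  have hin : |⟪hx t (x t), x s - x t⟫| ≤ c / 2 * |s - t| :=
    calc _ ≤ ‖hx t (x t)‖ * ‖x s - x t‖ := abs_real_inner_le_norm _ _
      _ ≤ |H| * (d * |s - t|) :=
        mul_le_mul ((hH (t, x t) ⟨htZ.1, hm htZ.1⟩).trans (le_abs_self H)) hLs (norm_nonneg _)
          (abs_nonneg _)
      _ ≤ _ := by rw [← mul_assoc]; gcongr
  have hlow : c * |s - t| ≤ |ht t (x t) * (s - t)| := by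
    rw [abs_mul]
    gcongr
    exact hcle (t, x t) ⟨⟨htZ.1, hm htZ.1⟩, htZ.2⟩
  have htri := abs_sub (ht t (x t) * (s - t) + ⟪hx t (x t), x s - x t⟫) ⟪hx t (x t), x s - x t⟫
  rw [add_sub_cancel_right] at htri
  have h0 : |s - t| = 0 := by
    have h5 := abs_nonneg (s - t)
    by_contra hne
    have h6 : 0 < |s - t| := lt_of_le_of_ne h5 (Ne.symm hne)
    nlinarith
  exact sub_eq_zero.1 (abs_eq_zero.1 h0)

/-- A curve with equal endpoints that solves a time-periodic integral equation over one period
extends to a periodic solution. -/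
lemma exists_periodic_extension [NormedSpace ℝ E] {T : ℝ} (hT : 0 < T) {g : ℝ → E → E}
    (hg : ∀ t x, g (t + T) x = g t x) {x : ℝ → E}
    (hint : IntervalIntegrable (fun s => g s (x s)) volume 0 T) (hxT : x T = x 0)
    (heq : ∀ t ∈ Icc 0 T, x t = x 0 + ∫ s in (0 : ℝ)..t, g s (x s)) :
    ∃ y : ℝ → E, Continuous y ∧ Function.Periodic y T ∧ y 0 = x 0 ∧
      (∀ t, y t ∈ x '' Icc 0 T) ∧ ∀ t₀ t, y t = y t₀ + ∫ s in t₀..t, g s (y s) := by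
  set y : ℝ → E := fun t => x (toIcoMod hT 0 t) with hy
  have hyper : Function.Periodic y T := fun t => by simp [hy]
  have hyx : ∀ t ∈ Ico 0 T, y t = x t := fun t ht => by
    simp only [hy]
    rw [(toIcoMod_eq_self hT).2 (by simpa using ht)]
  have hvper : Function.Periodic (fun s => g s (y s)) T := fun t => by simp only [hyper t, hg]
  have hTT : T ∈ Icc 0 T := ⟨hT.le, le_rfl⟩
  have hyx' : ∀ t ∈ Icc 0 T, y t = x t := fun t ht => by
    rcases ht.2.eq_or_lt with rfl | h
    · rw [hxT, ← hyx 0 ⟨le_rfl, hT⟩]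
      simpa using hyper 0
    · exact hyx t ⟨ht.1, h⟩
  have hveq : ∀ t ∈ Icc 0 T, EqOn (fun s => g s (x s)) (fun s => g s (y s)) (uIcc 0 t) :=
    fun t ht s hs => by
      rw [uIcc_of_le ht.1] at hs
      simp only [hyx' s ⟨hs.1, hs.2.trans ht.2⟩]
  have hvint : ∀ a b, IntervalIntegrable (fun s => g s (y s)) volume a b :=
    hvper.intervalIntegrable₀ hT.ne' (hint.congr ((hveq T hTT).mono uIoc_subset_uIcc))
  have hyeq : ∀ t ∈ Icc 0 T, y t = x 0 + ∫ s in (0 : ℝ)..t, g s (y s) := fun t ht => by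
    rw [hyx' t ht, heq t ht, intervalIntegral.integral_congr (hveq t ht)]
  have hv0 : ∫ s in (0 : ℝ)..T, g s (y s) = 0 := by
    simpa [hyx' T hTT, hxT] using hyeq T hTT
  have hGper : Function.Periodic (fun t => x 0 + ∫ s in (0 : ℝ)..t, g s (y s)) T := fun t => by
    have h1 := hvper.intervalIntegral_add_eq t 0
    rw [zero_add, hv0] at h1
    simp only
    rw [← intervalIntegral.integral_add_adjacent_intervals (hvint 0 t) (hvint t (t + T)), h1,
      add_zero]
  have hyG : ∀ t, y t = x 0 + ∫ s in (0 : ℝ)..t, g s (y s) := fun t => by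
    have h1 := hyeq (toIcoMod hT 0 t)
      (Ico_subset_Icc_self (by simpa using toIcoMod_mem_Ico hT 0 t))
    rw [toIcoMod, hyper.sub_zsmul_eq] at h1
    rw [h1]
    exact hGper.sub_zsmul_eq _
  refine ⟨y, ?_, hyper, hyx 0 ⟨le_rfl, hT⟩, fun t => ⟨_, Ico_subset_Icc_self
    (by simpa using toIcoMod_mem_Ico hT 0 t), rfl⟩, fun t₀ t => ?_⟩
  · rw [funext hyG]
    exact continuous_const.add (intervalIntegral.continuous_primitive hvint 0)
  · rw [hyG t, hyG t₀, add_assoc,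
      intervalIntegral.integral_add_adjacent_intervals (hvint 0 t₀) (hvint t₀ t)]

/-- If solutions exist with initial value arbitrarily close to `a` for small parameters, they can
be selected so that the initial value converges to `a`. -/
lemma exists_selection_tendsto {Sol : ℝ → (ℝ → E) → Prop} {a : E}
    (H : ∀ ρ > 0, ∃ δ > 0, ∀ ε, 0 < |ε| → |ε| < δ → ∃ x, Sol ε x ∧ dist (x 0) a ≤ ρ) :
    ∃ ε₂ > (0 : ℝ), ∃ sol : ℝ → ℝ → E, (∀ ε, 0 < |ε| → |ε| < ε₂ → Sol ε (sol ε)) ∧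
      Tendsto (fun ε => sol ε 0) (nhdsWithin 0 {ε : ℝ | ε ≠ 0}) (nhds a) := by
  have hbest : ∀ ε, ∃ x, (∃ x, Sol ε x) → 0 < |ε| →
      Sol ε x ∧ ∀ x', Sol ε x' → dist (x 0) a ≤ dist (x' 0) a + |ε| := fun ε => by
    by_cases hex : (∃ x, Sol ε x) ∧ 0 < |ε|
    · obtain ⟨⟨x₀, hx₀⟩, hε⟩ := hex
      have hbdd : BddBelow ((fun x : ℝ → E => dist (x 0) a) '' {x | Sol ε x}) :=
        ⟨0, by rintro _ ⟨x, -, rfl⟩; exact dist_nonneg⟩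
      obtain ⟨_, ⟨x, hx, rfl⟩, hlt⟩ := exists_lt_of_csInf_lt
        ⟨_, mem_image_of_mem (fun x : ℝ → E => dist (x 0) a) (show x₀ ∈ {x | Sol ε x} from hx₀)⟩
        (lt_add_of_pos_right _ hε)
      exact ⟨x, fun _ _ => ⟨hx, fun x' hx' =>
        hlt.le.trans (by gcongr; exact csInf_le hbdd ⟨x', hx', rfl⟩)⟩⟩
    · exact ⟨fun _ => a, fun h1 h2 => absurd ⟨h1, h2⟩ hex⟩
  choose sol hsol using hbest
  obtain ⟨ε₂, hε₂, hex⟩ := H 1 one_pos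
  refine ⟨ε₂, hε₂, sol, fun ε h0 h1 => ?_, Metric.tendsto_nhds.2 fun ρ hρ => ?_⟩
  · obtain ⟨x, hx, -⟩ := hex ε h0 h1
    exact (hsol ε ⟨x, hx⟩ h0).1
  · obtain ⟨δ, hδ, hδex⟩ := H (ρ / 2) (by positivity)
    have hsmall : ∀ᶠ ε : ℝ in nhdsWithin 0 {ε : ℝ | ε ≠ 0}, |ε| < min δ (ρ / 2) :=
      nhdsWithin_le_nhds ((continuous_abs.tendsto' (0 : ℝ) 0 abs_zero).eventually
        (gt_mem_nhds (lt_min hδ (by positivity))))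
    filter_upwards [hsmall, self_mem_nhdsWithin] with ε hε hne
    have h0 : 0 < |ε| := abs_pos.2 hne
    obtain ⟨x, hx, hxρ⟩ := hδex ε h0 (hε.trans_le (min_le_left _ _))
    linarith [(hsol ε ⟨x, hx⟩ h0).2 x hx, hε.trans_le (min_le_right _ _)]

/-- Locally Lipschitz continuous data combine to a perturbed field that is jointly continuous and
uniformly Lipschitz on a small ball. -/
lemma exists_lipschitzOnWith_add_smul [NormedSpace ℝ E] {D : Set E} (hD : IsOpen D)
    {F : ℝ → E → E} {R : ℝ → E → ℝ → E}
    (hlipF : ∀ x₀ ∈ D, ∃ U ∈ nhds x₀, ∃ L : ℝ, ∀ t : ℝ, ∀ x₁ ∈ U ∩ D, ∀ x₂ ∈ U ∩ D,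
      ‖F t x₁ - F t x₂‖ ≤ L * ‖x₁ - x₂‖)
    (hlipR : ∀ x₀ ∈ D, ∃ U ∈ nhds x₀, ∃ L : ℝ, ∀ t : ℝ, ∀ ε ∈ Ioo (-1 : ℝ) 1,
      ∀ x₁ ∈ U ∩ D, ∀ x₂ ∈ U ∩ D, ‖R t x₁ ε - R t x₂ ε‖ ≤ L * ‖x₁ - x₂‖) {a : E} (ha : a ∈ D) :
    ∃ U ∈ nhds a, ∃ L : NNReal, ∀ ε ∈ Ioo (-1 : ℝ) 1, ∀ s,
      LipschitzOnWith L (fun x => F s x + ε • R s x ε) U := by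
  obtain ⟨U, hU, L, hL⟩ := hlipF a ha
  obtain ⟨V, hV, M, hM⟩ := hlipR a ha
  refine ⟨(U ∩ V) ∩ D, inter_mem (inter_mem hU hV) (hD.mem_nhds ha), L.toNNReal + M.toNNReal,
    fun ε hε s => LipschitzOnWith.of_dist_le_mul fun x hx y hy => ?_⟩
  have h1 := hL s x ⟨hx.1.1, hx.2⟩ y ⟨hy.1.1, hy.2⟩
  have h2 := hM s ε hε x ⟨hx.1.2, hx.2⟩ y ⟨hy.1.2, hy.2⟩
  rw [dist_eq_norm, dist_eq_norm, NNReal.coe_add, add_mul, add_sub_add_comm, ← smul_sub]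
  refine norm_add_le_of_le (h1.trans ?_) ?_
  · gcongr
    exact L.le_coe_toNNReal
  · rw [norm_smul]
    refine (mul_le_of_le_one_left (norm_nonneg _) (abs_le.2 ⟨hε.1.le, hε.2.le⟩)).trans
      (h2.trans ?_)
    gcongr
    exact M.le_coe_toNNReal

lemma continuousOn_add_smul [NormedSpace ℝ E] {D : Set E} {F : ℝ → E → E} {R : ℝ → E → ℝ → E}
    (hF : ContinuousOn (fun p : ℝ × E => F p.1 p.2) (univ ×ˢ D))
    (hR : ContinuousOn (fun p : ℝ × E × ℝ => R p.1 p.2.1 p.2.2)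
      (univ ×ˢ D ×ˢ Ioo (-1 : ℝ) 1)) :
    ContinuousOn (fun p : ℝ × ℝ × E => F p.2.1 p.2.2 + p.1 • R p.2.1 p.2.2 p.1)
      (Ioo (-1) 1 ×ˢ univ ×ˢ D) := by
  refine (hF.comp continuousOn_snd fun p hp => hp.2).add (continuousOn_fst.smul ?_)
  exact hR.comp (f := fun p : ℝ × ℝ × E => (p.2.1, p.2.2, p.1)) (by fun_prop)
    fun p hp => ⟨mem_univ _, hp.2.2, hp.1⟩

/-- A locally Lipschitz perturbed field with smooth switching function is regular on all small
balls. -/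
lemma exists_isSwitchedData [InnerProductSpace ℝ E] [FiniteDimensional ℝ E] (T : ℝ) {D C : Set E}
    {P Q : ℝ → ℝ → E → E} {h ht : ℝ → E → ℝ} {hx : ℝ → E → E}
    (hP : ContinuousOn (fun p : ℝ × ℝ × E => P p.1 p.2.1 p.2.2) (Ioo (-1) 1 ×ˢ univ ×ˢ D))
    (hQ : ContinuousOn (fun p : ℝ × ℝ × E => Q p.1 p.2.1 p.2.2) (Ioo (-1) 1 ×ˢ univ ×ˢ D))
    {a : E}
    (hlipP : ∃ U ∈ nhds a, ∃ L : NNReal, ∀ ε ∈ Ioo (-1 : ℝ) 1, ∀ s, LipschitzOnWith L (P ε s) U)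
    (hlipQ : ∃ U ∈ nhds a, ∃ L : NNReal, ∀ ε ∈ Ioo (-1 : ℝ) 1, ∀ s, LipschitzOnWith L (Q ε s) U)
    (hder : ∀ t, ∀ x ∈ D, HasFDerivAt (fun p : ℝ × E => h p.1 p.2)
      ((ht t x) • ContinuousLinearMap.fst ℝ ℝ E +
        (innerSL ℝ (hx t x)).comp (ContinuousLinearMap.snd ℝ ℝ E)) (t, x))
    (hhxc : ContinuousOn (fun p : ℝ × E => hx p.1 p.2) (univ ×ˢ D))
    (hCopen : IsOpen C) (hCD : C ⊆ D) (ha : a ∈ C) :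
    ∃ r : NNReal, 0 < r ∧ closedBall a r ⊆ C ∧ ∃ B L : NNReal,
      IsSwitchedData T (1 / 2) (closedBall a r) B L P Q h := by
  obtain ⟨U, hU, L, hL⟩ := hlipP
  obtain ⟨V, hV, M, hM⟩ := hlipQ
  obtain ⟨r, hr, hrsub⟩ := nhds_basis_closedBall.mem_iff.1
    (inter_mem (hCopen.mem_nhds ha) (inter_mem hU hV))
  lift r to NNReal using hr.le
  have hrC : closedBall a (r : ℝ) ⊆ C := fun x hx => (hrsub hx).1
  have hrD : closedBall a (r : ℝ) ⊆ D := hrC.trans hCD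
  have he : Icc (-(1 / 2)) (1 / 2) ⊆ Ioo (-1 : ℝ) 1 := Icc_subset_Ioo (by norm_num) (by norm_num)
  have hsub : Icc (-(1 / 2) : ℝ) (1 / 2) ×ˢ Icc 0 T ×ˢ closedBall a (r : ℝ) ⊆
      Ioo (-1) 1 ×ˢ univ ×ˢ D := prod_mono he (prod_mono (subset_univ _) hrD)
  have hcomp : IsCompact (Icc (-(1 / 2) : ℝ) (1 / 2) ×ˢ Icc 0 T ×ˢ closedBall a (r : ℝ)) :=
    isCompact_Icc.prod (isCompact_Icc.prod (isCompact_closedBall a r))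
  obtain ⟨B₁, hB₁⟩ := hcomp.exists_bound_of_continuousOn (hP.mono hsub)
  obtain ⟨B₂, hB₂⟩ := hcomp.exists_bound_of_continuousOn (hQ.mono hsub)
  obtain ⟨H, hH⟩ := (isCompact_Icc.prod (isCompact_closedBall a r)).exists_bound_of_continuousOn
    (hhxc.mono (prod_mono (subset_univ (Icc 0 T)) hrD))
  refine ⟨r, hr, hrC, B₁.toNNReal + B₂.toNNReal, L + M + H.toNNReal, hP.mono hsub, hQ.mono hsub,
    fun p hp => (hder p.1 p.2 (hrD hp.2)).continuousAt.continuousWithinAt,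
    fun ε hε s hs x hx => (hB₁ (ε, s, x) ⟨hε, hs, hx⟩).trans ?_,
    fun ε hε s hs x hx => (hB₂ (ε, s, x) ⟨hε, hs, hx⟩).trans ?_,
    fun ε hε s hs => ((hL ε (he hε) s).mono fun x hx => (hrsub hx).2.1).weaken ?_,
    fun ε hε s hs => ((hM ε (he hε) s).mono fun x hx => (hrsub hx).2.2).weaken ?_,
    fun s hs => LipschitzOnWith.weaken
      ((convex_closedBall a (r : ℝ)).lipschitzOnWith_of_nnnorm_hasFDerivWithin_le
        (f' := fun x => innerSL ℝ (hx s x)) (C := H.toNNReal) (fun x hxr => ?_) fun x hxr => ?_) ?_⟩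
  · push_cast
    linarith [B₁.le_coe_toNNReal, B₂.toNNReal.coe_nonneg]
  · push_cast
    linarith [B₂.le_coe_toNNReal, B₁.toNNReal.coe_nonneg]
  · rw [add_assoc]; exact le_self_add
  · rw [add_right_comm]; exact le_add_self
  · have h1 := (hder s x (hrD hxr)).comp x
      ((hasFDerivAt_const s x).prodMk (hasFDerivAt_id (𝕜 := ℝ) x))
    refine (h1.congr_fderiv ?_).hasFDerivWithinAt
    exact ContinuousLinearMap.ext fun v => by simp
  · rw [← NNReal.coe_le_coe, coe_nnnorm, innerSL_apply_norm]
    exact (hH (s, x) ⟨hs, hxr⟩).trans H.le_coe_toNNReal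
  · exact le_add_self

end Reduction

/-- Averaging for discontinuous systems `x' = εF(t,x) + ε²R(t,x,ε)` with
`F = F1 + sgn(h) F2`, `R = R1 + sgn(h) R2` (Theorem A): under the crossing hypothesis (ii)
and the nondegenerate-zero hypothesis (iii) on the averaged function `f`, for every
sufficiently small `ε ≠ 0` there is a `T`-periodic crossing solution `x(·,ε)` with
`x(0,ε) → a` as `ε → 0`. -/
theorem averaging_discontinuous_systems {n : ℕ} (T : ℝ) (hT : 0 < T)
    (D : Set (EuclideanSpace ℝ (Fin n))) (hD : IsOpen D)
    (F1 F2 : ℝ → EuclideanSpace ℝ (Fin n) → EuclideanSpace ℝ (Fin n))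
    (R1 R2 : ℝ → EuclideanSpace ℝ (Fin n) → ℝ → EuclideanSpace ℝ (Fin n))
    (h ht : ℝ → EuclideanSpace ℝ (Fin n) → ℝ)
    (hx : ℝ → EuclideanSpace ℝ (Fin n) → EuclideanSpace ℝ (Fin n))
    -- continuity of the data on ℝ × D (and ε ∈ (−1,1) for R1, R2)
    (hF1c : ContinuousOn (fun p : ℝ × EuclideanSpace ℝ (Fin n) => F1 p.1 p.2) (univ ×ˢ D))
    (hF2c : ContinuousOn (fun p : ℝ × EuclideanSpace ℝ (Fin n) => F2 p.1 p.2) (univ ×ˢ D))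
    (hR1c : ContinuousOn (fun p : ℝ × EuclideanSpace ℝ (Fin n) × ℝ => R1 p.1 p.2.1 p.2.2)
      (univ ×ˢ D ×ˢ Ioo (-1 : ℝ) 1))
    (hR2c : ContinuousOn (fun p : ℝ × EuclideanSpace ℝ (Fin n) × ℝ => R2 p.1 p.2.1 p.2.2)
      (univ ×ˢ D ×ˢ Ioo (-1 : ℝ) 1))
    -- T-periodicity in t
    (hF1per : ∀ t x, F1 (t + T) x = F1 t x)
    (hF2per : ∀ t x, F2 (t + T) x = F2 t x)
    (hR1per : ∀ t x ε, R1 (t + T) x ε = R1 t x ε)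
    (hR2per : ∀ t x ε, R2 (t + T) x ε = R2 t x ε)
    (hhper : ∀ t x, h (t + T) x = h t x)
    -- local Lipschitz continuity with respect to x
    (hlipF1 : ∀ x₀ ∈ D, ∃ U ∈ nhds x₀, ∃ L : ℝ, ∀ t : ℝ, ∀ x₁ ∈ U ∩ D, ∀ x₂ ∈ U ∩ D,
      ‖F1 t x₁ - F1 t x₂‖ ≤ L * ‖x₁ - x₂‖)
    (hlipF2 : ∀ x₀ ∈ D, ∃ U ∈ nhds x₀, ∃ L : ℝ, ∀ t : ℝ, ∀ x₁ ∈ U ∩ D, ∀ x₂ ∈ U ∩ D,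
      ‖F2 t x₁ - F2 t x₂‖ ≤ L * ‖x₁ - x₂‖)
    (hlipR1 : ∀ x₀ ∈ D, ∃ U ∈ nhds x₀, ∃ L : ℝ, ∀ t : ℝ, ∀ ε ∈ Ioo (-1 : ℝ) 1,
      ∀ x₁ ∈ U ∩ D, ∀ x₂ ∈ U ∩ D, ‖R1 t x₁ ε - R1 t x₂ ε‖ ≤ L * ‖x₁ - x₂‖)
    (hlipR2 : ∀ x₀ ∈ D, ∃ U ∈ nhds x₀, ∃ L : ℝ, ∀ t : ℝ, ∀ ε ∈ Ioo (-1 : ℝ) 1,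
      ∀ x₁ ∈ U ∩ D, ∀ x₂ ∈ U ∩ D, ‖R2 t x₁ ε - R2 t x₂ ε‖ ≤ L * ‖x₁ - x₂‖)
    -- h is C¹ with partial derivatives ∂ₜh = ht and ∂ₓh = hx
    (hder : ∀ t : ℝ, ∀ x ∈ D,
      HasFDerivAt (fun p : ℝ × EuclideanSpace ℝ (Fin n) => h p.1 p.2)
        ((ht t x) • ContinuousLinearMap.fst ℝ ℝ (EuclideanSpace ℝ (Fin n)) +
          (innerSL ℝ (hx t x)).comp (ContinuousLinearMap.snd ℝ ℝ (EuclideanSpace ℝ (Fin n))))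
        (t, x))
    (hhtc : ContinuousOn (fun p : ℝ × EuclideanSpace ℝ (Fin n) => ht p.1 p.2) (univ ×ˢ D))
    (hhxc : ContinuousOn (fun p : ℝ × EuclideanSpace ℝ (Fin n) => hx p.1 p.2) (univ ×ˢ D))
    -- 0 is a regular value of h
    (hreg : ∀ t : ℝ, ∀ x ∈ D, h t x = 0 → (ht t x ≠ 0 ∨ hx t x ≠ 0))
    -- hypothesis (ii): crossing hypothesis on an open bounded set C
    (C : Set (EuclideanSpace ℝ (Fin n))) (hCopen : IsOpen C)
    (hCbdd : Bornology.IsBounded C) (hCcl : closure C ⊆ D)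
    (ε₁ : ℝ) (hε₁ : ε₁ ∈ Ioo (0 : ℝ) 1)
    (hii : ∀ ε : ℝ, |ε| < ε₁ → ∀ x : ℝ → EuclideanSpace ℝ (Fin n),
      ContinuousOn x (Icc (0 : ℝ) T) → (∀ t ∈ Icc (0 : ℝ) T, x t ∈ D) → x 0 ∈ C →
      (∀ t₀ ∈ Icc (0 : ℝ) T, ∀ t ∈ Icc (0 : ℝ) T,
        x t = x t₀ + ∫ s in t₀..t,
          (ε • (F1 s (x s) + Real.sign (h s (x s)) • F2 s (x s)) +
            ε ^ 2 • (R1 s (x s) ε + Real.sign (h s (x s)) • R2 s (x s) ε))) →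
      ∀ t ∈ Icc (0 : ℝ) T, h t (x t) = 0 →
        (∃ η > 0, ∀ s ∈ Icc (0 : ℝ) T, h s (x s) = 0 → |s - t| < η → s = t) ∧
        0 < (ht t (x t) + ⟪hx t (x t),
              ε • (F1 t (x t) + F2 t (x t)) + ε ^ 2 • (R1 t (x t) ε + R2 t (x t) ε)⟫) *
            (ht t (x t) + ⟪hx t (x t),
              ε • (F1 t (x t) - F2 t (x t)) + ε ^ 2 • (R1 t (x t) ε - R2 t (x t) ε)⟫))
    -- hypothesis (iii): a is a zero of the averaged function f with invertible derivative
    (a : EuclideanSpace ℝ (Fin n)) (ha : a ∈ C)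
    (hfa : (∫ t in (0 : ℝ)..T, (F1 t a + Real.sign (h t a) • F2 t a)) = 0)
    (Df : EuclideanSpace ℝ (Fin n) ≃L[ℝ] EuclideanSpace ℝ (Fin n))
    (hdf : HasFDerivAt (fun z => ∫ t in (0 : ℝ)..T, (F1 t z + Real.sign (h t z) • F2 t z))
      (Df : EuclideanSpace ℝ (Fin n) →L[ℝ] EuclideanSpace ℝ (Fin n)) a) :
    ∃ ε₂ > (0 : ℝ), ∃ sol : ℝ → ℝ → EuclideanSpace ℝ (Fin n),
      (∀ ε : ℝ, 0 < |ε| → |ε| < ε₂ →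
        Continuous (sol ε) ∧ (∀ t, sol ε t ∈ D) ∧ Function.Periodic (sol ε) T ∧
        ∀ t₀ t : ℝ, sol ε t = sol ε t₀ + ∫ s in t₀..t,
          (ε • (F1 s (sol ε s) + Real.sign (h s (sol ε s)) • F2 s (sol ε s)) +
            ε ^ 2 • (R1 s (sol ε s) ε + Real.sign (h s (sol ε s)) • R2 s (sol ε s) ε))) ∧
      Tendsto (fun ε => sol ε 0) (nhdsWithin 0 {ε : ℝ | ε ≠ 0}) (nhds a) := by
  have hCD : C ⊆ D := subset_closure.trans hCcl
  set P : ℝ → ℝ → EuclideanSpace ℝ (Fin n) → EuclideanSpace ℝ (Fin n) :=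
    fun ε s x => F1 s x + ε • R1 s x ε
  set Q : ℝ → ℝ → EuclideanSpace ℝ (Fin n) → EuclideanSpace ℝ (Fin n) :=
    fun ε s x => F2 s x + ε • R2 s x ε
  have hfield : ∀ ε s x, ε • switchedField P Q h Real.sign ε s x =
      ε • (F1 s x + Real.sign (h s x) • F2 s x) +
        ε ^ 2 • (R1 s x ε + Real.sign (h s x) • R2 s x ε) := fun ε s x => by
    simp only [switchedField, P, Q]
    module
  have hfield0 : ∀ s x, switchedField P Q h Real.sign 0 s x =
      F1 s x + Real.sign (h s x) • F2 s x := fun s x => by simp [switchedField, P, Q]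
  obtain ⟨r, hr, hrC, B, L, S⟩ := exists_isSwitchedData T (P := P) (Q := Q)
    (continuousOn_add_smul hF1c hR1c) (continuousOn_add_smul hF2c hR2c)
    (exists_lipschitzOnWith_add_smul hD hlipF1 hlipR1 (hCD ha))
    (exists_lipschitzOnWith_add_smul hD hlipF2 hlipR2 (hCD ha)) hder hhxc hCopen hCD ha
  have htr : ∀ t ∈ Icc 0 T, ∀ x ∈ Metric.closedBall a (r : ℝ), h t x = 0 → ht t x ≠ 0 :=
    fun t htT x hxr h0 => by
      have hpos := (hii 0 (by simpa using hε₁.1) (fun _ => x) continuousOn_const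
        (fun _ _ => hCD (hrC hxr)) (hrC hxr) (fun _ _ _ _ => by simp) t htT h0).2
      intro hz
      simp [hz] at hpos
  have hrD : Icc 0 T ×ˢ Metric.closedBall a (r : ℝ) ⊆ univ ×ˢ D :=
    prod_mono (subset_univ _) (hrC.trans hCD)
  obtain ⟨δ₀, hδ₀, hnull⟩ := exists_lipschitz_curve_null (isCompact_closedBall a (r : ℝ))
    (fun t x hxr => hder t x (hCD (hrC hxr))) (hhtc.mono hrD) (hhxc.mono hrD) htr
  refine exists_selection_tendsto (E := EuclideanSpace ℝ (Fin n))
    (Sol := fun ε x => Continuous x ∧ (∀ t, x t ∈ D) ∧ Function.Periodic x T ∧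
      ∀ t₀ t : ℝ, x t = x t₀ + ∫ s in t₀..t,
        (ε • (F1 s (x s) + Real.sign (h s (x s)) • F2 s (x s)) +
          ε ^ 2 • (R1 s (x s) ε + Real.sign (h s (x s)) • R2 s (x s) ε))) fun ρ hρ => ?_
  obtain ⟨δ, hδ, hex⟩ := S.exists_periodic_sign hT (by norm_num) hr hδ₀ hnull
    (fun z _ => by simp only [hfield0]) hfa hdf hρ
  refine ⟨min δ (1 / 2), lt_min hδ (by norm_num), fun ε hε0 hε => ?_⟩
  have hεe : ε ∈ Icc (-(1 / 2) : ℝ) (1 / 2) := abs_le.1 (hε.le.trans (min_le_right _ _))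
  obtain ⟨x, hxc, hxK, hxρ, hxT, hxeq⟩ := hex ε hεe hε0 (hε.trans_le (min_le_left _ _))
  obtain ⟨y, hyc, hyper, hy0, hyx, hyeq⟩ := exists_periodic_extension hT
    (g := fun s x => ε • switchedField P Q h Real.sign ε s x)
    (fun t x => by simp only [hfield, hF1per, hF2per, hR1per, hR2per, hhper])
    ((S.intervalIntegrable_switchedField measurable_realSign abs_realSign_le hεe hxc hxK
      ⟨hT.le, le_rfl⟩).smul ε) hxT hxeq
  refine ⟨y, ⟨hyc, fun t => ?_, hyper, ?_⟩, by rwa [hy0]⟩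
  · obtain ⟨s, hs, hsy⟩ := hyx t
    exact hsy ▸ hCD (hrC (hxK hs))
  · simpa only [hfield] using hyeq
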